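/- Let L(x,y) = |x-y|/(2·artanh(|x-y|/(x+y))) be the logarithmic mean (for x ≠ y, with L(x,x) = x) and let S_tan(x,y) = |x-y|/(2·tan(|x-y|/(x+y))) for x ≠ y, S_tan(x,x) = x. Then for all x,y with 0 < x,y ≤ 1/2 and x ≠ y, L(x,y)/L(1-x,1-y) < S_tan(x,y)/S_tan(1-x,1-y). -/

import Mathlib

/-- The inverse hyperbolic tangent, `artanh z = (1/2) log((1+z)/(1-z))`. -/
noncomputable def artanh (z : ℝ) : ℝ :=
  (1 / 2) * Real.log ((1 + z) / (1 - z))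

/-- The logarithmic mean, written via its Seiffert function `artanh`. -/
noncomputable def logMean (x y : ℝ) : ℝ :=
  if x = y then x else |x - y| / (2 * artanh (|x - y| / (x + y)))

/-- The mean with Seiffert function `tan`. -/
noncomputable def tanMean (x y : ℝ) : ℝ :=
  if x = y then x else |x - y| / (2 * Real.tan (|x - y| / (x + y)))

theorem hasDerivAt_artanh {z : ℝ} (h₁ : -1 < z) (h₂ : z < 1) :
    HasDerivAt artanh (1 / (1 - z ^ 2)) z := by
  have hp : 1 + z ≠ 0 := by linarith
  have hm : 1 - z ≠ 0 := by linarith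
  have hs : 1 - z ^ 2 ≠ 0 := by
    rw [show 1 - z ^ 2 = (1 + z) * (1 - z) by ring]
    exact mul_ne_zero hp hm
  have h := (((((hasDerivAt_id' z).const_add 1).div ((hasDerivAt_id' z).const_sub 1) hm).log
    (div_ne_zero hp hm)).const_mul (1 / 2))
  refine h.congr_deriv ?_
  simp only [Pi.div_apply]
  field_simp
  ring

theorem artanh_zero : artanh 0 = 0 := by simp [artanh]

theorem artanh_pos {z : ℝ} (h₀ : 0 < z) (h₁ : z < 1) : 0 < artanh z := by
  have h : 1 < (1 + z) / (1 - z) := by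
    rw [one_lt_div (by linarith)]
    linarith
  have := Real.log_pos h
  unfold artanh
  positivity

theorem sin_mul_one_sub_sq_lt {z : ℝ} (h₀ : 0 < z) (h₁ : z < 1) :
    Real.sin z * (1 - z ^ 2) < z * Real.cos z := by
  have hs : 0 < 1 - z ^ 2 := by nlinarith
  calc Real.sin z * (1 - z ^ 2) < z * (1 - z ^ 2) := by
        gcongr
        exact Real.sin_lt h₀
    _ ≤ z * (1 - z ^ 2 / 2) := by gcongr; nlinarith
    _ ≤ z * Real.cos z := by
        gcongr
        exact Real.one_sub_sq_div_two_le_cos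

theorem artanh_lt_sin_mul_cos_div {z : ℝ} (h₀ : 0 < z) (h₁ : z < 1) :
    artanh z < Real.sin z * Real.cos z / (1 - z ^ 2) := by
  let h : ℝ → ℝ := fun t ↦ Real.sin t * Real.cos t / (1 - t ^ 2) - artanh t
  have hd : ∀ t, 0 ≤ t → t < 1 → HasDerivAt h
      (2 * Real.sin t * (t * Real.cos t - Real.sin t * (1 - t ^ 2)) / (1 - t ^ 2) ^ 2) t := by
    intro t ht₀ ht₁
    have hs : 1 - t ^ 2 ≠ 0 := by nlinarith
    have := ((((Real.hasDerivAt_sin t).mul (Real.hasDerivAt_cos t)).div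
      ((hasDerivAt_pow 2 t).const_sub 1) hs).sub (hasDerivAt_artanh (by linarith) ht₁))
    refine this.congr_deriv ?_
    simp only [Pi.mul_apply]
    field_simp
    push_cast
    linear_combination (1 - t ^ 2) * Real.sin_sq_add_cos_sq t
  have hmono : StrictMonoOn h (Set.Ico 0 1) := by
    refine strictMonoOn_of_deriv_pos (convex_Ico 0 1)
      (fun t ht ↦ (hd t ht.1 ht.2).continuousAt.continuousWithinAt) fun t ht ↦ ?_
    rw [interior_Ico] at ht
    rw [(hd t ht.1.le ht.2).deriv]
    have hsin := Real.sin_pos_of_pos_of_lt_pi ht.1 (by linarith [ht.2, Real.pi_gt_three])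
    have hk := sub_pos.2 (sin_mul_one_sub_sq_lt ht.1 ht.2)
    have hs : 0 < 1 - t ^ 2 := by nlinarith [ht.1, ht.2]
    positivity
  have := hmono ⟨le_rfl, one_pos⟩ ⟨h₀.le, h₁⟩ h₀
  simpa [h, artanh_zero] using this

theorem tan_pos_of_lt_one {z : ℝ} (h₀ : 0 < z) (h₁ : z < 1) : 0 < Real.tan z :=
  Real.tan_pos_of_pos_of_lt_pi_div_two h₀ (by linarith [Real.pi_gt_three])

theorem strictMonoOn_artanh_div_tan :
    StrictMonoOn (fun t ↦ artanh t / Real.tan t) (Set.Ioo 0 1) := by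
  have hcos : ∀ t ∈ Set.Ioo (0 : ℝ) 1, 0 < Real.cos t := fun t ht ↦
    Real.cos_pos_of_mem_Ioo
      ⟨by linarith [ht.1, Real.pi_pos], by linarith [ht.2, Real.pi_gt_three]⟩
  have hd : ∀ t ∈ Set.Ioo (0 : ℝ) 1, HasDerivAt (fun t ↦ artanh t / Real.tan t)
      ((1 / (1 - t ^ 2) * Real.tan t - artanh t * (1 / Real.cos t ^ 2)) / Real.tan t ^ 2) t :=
    fun t ht ↦ (hasDerivAt_artanh (by linarith [ht.1]) ht.2).div
      (Real.hasDerivAt_tan (hcos t ht).ne') (tan_pos_of_lt_one ht.1 ht.2).ne'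
  refine strictMonoOn_of_deriv_pos (convex_Ioo 0 1)
    (fun t ht ↦ (hd t ht).continuousAt.continuousWithinAt) fun t ht ↦ ?_
  rw [interior_Ioo] at ht
  rw [(hd t ht).deriv]
  have hc := hcos t ht
  refine div_pos ?_ (pow_pos (tan_pos_of_lt_one ht.1 ht.2) 2)
  have key : 1 / (1 - t ^ 2) * Real.tan t - artanh t * (1 / Real.cos t ^ 2) =
      (Real.sin t * Real.cos t / (1 - t ^ 2) - artanh t) / Real.cos t ^ 2 := by
    rw [Real.tan_eq_sin_div_cos]
    field_simp
  rw [key]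
  exact div_pos (sub_pos.2 (artanh_lt_sin_mul_cos_div ht.1 ht.2)) (pow_pos hc 2)

/-- `L(x,y)/L(1-x,1-y) < S_tan(x,y)/S_tan(1-x,1-y)` for
`0 < x,y ≤ 1/2`, `x ≠ y`. -/
theorem kyFan_logMean_lt_tanMean :
    ∀ x y : ℝ, 0 < x → x ≤ 1 / 2 → 0 < y → y ≤ 1 / 2 → x ≠ y →
      logMean x y / logMean (1 - x) (1 - y) <
        tanMean x y / tanMean (1 - x) (1 - y) := by
  intro x y hx hx' hy hy' hxy
  have hd : 0 < |x - y| := abs_pos.2 (sub_ne_zero.2 hxy)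
  have hsum : x + y < 1 := by
    rcases lt_or_gt_of_ne hxy with h | h <;> linarith
  have hxy' : 1 - x ≠ 1 - y := fun h ↦ hxy (by linarith)
  have habs : |(1 - x) - (1 - y)| = |x - y| := by
    rw [show (1 - x) - (1 - y) = y - x by ring, abs_sub_comm]
  simp only [logMean, tanMean, if_neg hxy, if_neg hxy', habs]
  have hu₁ : |x - y| / (x + y) < 1 := by
    rw [div_lt_one (by linarith), abs_lt]
    constructor <;> linarith
  have hv₀ : 0 < |x - y| / (1 - x + (1 - y)) := div_pos hd (by linarith)
  have hvu : |x - y| / (1 - x + (1 - y)) < |x - y| / (x + y) :=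
    div_lt_div_of_pos_left hd (by linarith) (by linarith)
  generalize |x - y| / (x + y) = u at *
  generalize |x - y| / (1 - x + (1 - y)) = v at *
  generalize |x - y| = d at *
  have hu₀ := hv₀.trans hvu
  have hv₁ := hvu.trans hu₁
  have hmono := strictMonoOn_artanh_div_tan ⟨hv₀, hv₁⟩ ⟨hu₀, hu₁⟩ hvu
  have hAu := artanh_pos hu₀ hu₁
  have hAv := artanh_pos hv₀ hv₁
  have hTu := tan_pos_of_lt_one hu₀ hu₁
  have hTv := tan_pos_of_lt_one hv₀ hv₁
  have hratio : ∀ a b : ℝ, 0 < a → 0 < b → d / (2 * a) / (d / (2 * b)) = b / a := by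
    intro a b ha hb
    field_simp
  rw [hratio _ _ hAu hAv, hratio _ _ hTu hTv, div_lt_div_iff₀ hAu hTu]
  rw [div_lt_div_iff₀ hTv hTu] at hmono
  linarith
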